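/- Let K ⊂ ℝⁿ be a convex body with B₂ⁿ ⊆ K ⊆ R·B₂ⁿ for some R ≥ 1, let h_K be its support function, and let 0 < δ < 1. Let 𝒩 ⊆ S^{n−1} be a (δ/(2R))-net of the unit sphere, meaning that for every θ ∈ S^{n−1} there exists α ∈ 𝒩 with |α − θ| < δ/(2R). Define P_δ := {x ∈ ℝⁿ : ⟨α, x⟩ ≤ h_K(α) for all α ∈ 𝒩}. Then (1−δ)·P_δ ⊆ K ⊆ P_δ. -/

import Mathlib

open RealInnerProductSpace Pointwise

/-- A convex body: compact, convex, with nonempty interior. -/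
def IsConvexBody {n : ℕ} (K : Set (EuclideanSpace ℝ (Fin n))) : Prop :=
  IsCompact K ∧ Convex ℝ K ∧ (interior K).Nonempty

/-- The support function of a set. -/
noncomputable def suppFn {n : ℕ} (K : Set (EuclideanSpace ℝ (Fin n)))
    (x : EuclideanSpace ℝ (Fin n)) : ℝ :=
  sSup ((fun y => ⟪x, y⟫) '' K)

theorem inner_le_suppFn {n : ℕ} {K : Set (EuclideanSpace ℝ (Fin n))} (hK : IsCompact K)
    (x : EuclideanSpace ℝ (Fin n)) {y : EuclideanSpace ℝ (Fin n)} (hy : y ∈ K) :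
    ⟪x, y⟫ ≤ suppFn K x :=
  le_csSup (hK.image (by fun_prop)).bddAbove ⟨y, hy, rfl⟩

theorem suppFn_le {n : ℕ} {K : Set (EuclideanSpace ℝ (Fin n))} (hK : K.Nonempty)
    {x : EuclideanSpace ℝ (Fin n)} {c : ℝ} (h : ∀ y ∈ K, ⟪x, y⟫ ≤ c) : suppFn K x ≤ c :=
  csSup_le (hK.image _) (Set.forall_mem_image.2 h)

/-- The support function of a set contained in a ball of radius `R` is `R`-Lipschitz. -/
theorem suppFn_le_add {n : ℕ} {K : Set (EuclideanSpace ℝ (Fin n))} (hK : IsCompact K)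
    (hne : K.Nonempty) {R : ℝ} (hR : ∀ y ∈ K, ‖y‖ ≤ R) (x z : EuclideanSpace ℝ (Fin n)) :
    suppFn K x ≤ suppFn K z + ‖x - z‖ * R := by
  refine suppFn_le hne fun y hy => ?_
  have h1 : ⟪x - z, y⟫ ≤ ‖x - z‖ * R :=
    (real_inner_le_norm _ _).trans (mul_le_mul_of_nonneg_left (hR y hy) (norm_nonneg _))
  have h2 := inner_le_suppFn hK z hy
  rw [inner_sub_left] at h1
  linarith

/-- A point outside a compact convex set is strictly separated from it by a unit direction. -/
theorem exists_unit_suppFn_lt_inner {n : ℕ} {K : Set (EuclideanSpace ℝ (Fin n))}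
    (hK : IsCompact K) (hconv : Convex ℝ K) (hne : K.Nonempty)
    {y : EuclideanSpace ℝ (Fin n)} (hy : y ∉ K) :
    ∃ θ : EuclideanSpace ℝ (Fin n), ‖θ‖ = 1 ∧ suppFn K θ < ⟪θ, y⟫ := by
  obtain ⟨f, u, hfu, huy⟩ := geometric_hahn_banach_closed_point hconv hK.isClosed hy
  obtain ⟨v, rfl⟩ := (InnerProductSpace.toDual ℝ (EuclideanSpace ℝ (Fin n))).surjective f
  simp only [InnerProductSpace.toDual_apply_apply] at hfu huy
  have hv : v ≠ 0 := by
    rintro rfl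
    obtain ⟨a, ha⟩ := hne
    have := hfu a ha
    simp only [inner_zero_left] at this huy
    linarith
  have hv' : 0 < ‖v‖⁻¹ := inv_pos.2 (norm_pos_iff.2 hv)
  refine ⟨‖v‖⁻¹ • v, norm_smul_inv_norm hv, ?_⟩
  have hle : suppFn K (‖v‖⁻¹ • v) ≤ ‖v‖⁻¹ * u := by
    refine suppFn_le hne fun a ha => ?_
    rw [real_inner_smul_left]
    exact mul_le_mul_of_nonneg_left (hfu a ha).le hv'.le
  rw [real_inner_smul_left]
  exact hle.trans_lt (mul_lt_mul_of_pos_left huy hv')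

theorem net_polytope_sandwich
    {n : ℕ} (K : Set (EuclideanSpace ℝ (Fin n))) (hK : IsConvexBody K)
    (R : ℝ) (hR : 1 ≤ R)
    (hball : Metric.closedBall 0 1 ⊆ K)
    (hsub : K ⊆ R • Metric.closedBall (0 : EuclideanSpace ℝ (Fin n)) 1)
    (δ : ℝ) (hδ0 : 0 < δ) (hδ1 : δ < 1)
    (N : Set (EuclideanSpace ℝ (Fin n)))
    (hN : N ⊆ Metric.sphere 0 1)
    (hnet : ∀ θ ∈ Metric.sphere (0 : EuclideanSpace ℝ (Fin n)) 1,
      ∃ α ∈ N, ‖α - θ‖ < δ / (2 * R)) :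
    (1 - δ) • {x : EuclideanSpace ℝ (Fin n) | ∀ α ∈ N, ⟪α, x⟫ ≤ suppFn K α} ⊆ K ∧
    K ⊆ {x : EuclideanSpace ℝ (Fin n) | ∀ α ∈ N, ⟪α, x⟫ ≤ suppFn K α} := by
  obtain ⟨hcomp, hconv, -⟩ := hK
  have hne : K.Nonempty := ⟨0, hball (by simp)⟩
  have hR0 : 0 < R := by linarith
  have hnorm : ∀ y ∈ K, ‖y‖ ≤ R := by
    intro y hy
    obtain ⟨b, hb, rfl⟩ := hsub hy
    have hb1 : ‖b‖ ≤ 1 := by simpa using hb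
    simp only [norm_smul, Real.norm_eq_abs, abs_of_pos hR0]
    exact mul_le_of_le_one_right hR0.le hb1
  refine ⟨?_, fun x hx α _ => inner_le_suppFn hcomp α hx⟩
  rintro _ ⟨x, hx, rfl⟩
  by_contra hxK
  obtain ⟨θ, hθ, hlt⟩ := exists_unit_suppFn_lt_inner hcomp hconv hne hxK
  simp only [real_inner_smul_right] at hlt
  set ε := δ / (2 * R) with hε
  have hεR : ε * R = δ / 2 := by rw [hε]; field_simp
  have hε0 : 0 < ε := by positivity
  have hεδ : ε ≤ δ / 2 := by nlinarith
  have key : ∀ φ : EuclideanSpace ℝ (Fin n), ‖φ‖ = 1 →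
      ∃ α ∈ N, ‖α - φ‖ ≤ ε ∧ ⟪φ, x⟫ ≤ suppFn K α + ε * ‖x‖ := by
    intro φ hφ
    obtain ⟨α, hα, hd⟩ := hnet φ (by simpa using hφ)
    refine ⟨α, hα, hd.le, ?_⟩
    have h1 : ⟪φ - α, x⟫ ≤ ε * ‖x‖ := (real_inner_le_norm _ _).trans
      (mul_le_mul_of_nonneg_right (by rw [norm_sub_rev]; exact hd.le) (norm_nonneg _))
    rw [inner_sub_left] at h1
    linarith [hx α hα]
  have hxR : ‖x‖ * (1 - ε) ≤ R := by
    rcases eq_or_ne x 0 with rfl | hx0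
    · simpa using hR0.le
    · obtain ⟨α, hα, -, h⟩ := key (‖x‖⁻¹ • x) (norm_smul_inv_norm hx0)
      have hαR : suppFn K α ≤ R := suppFn_le hne fun y hy => by
        have hα1 : ‖α‖ = 1 := by simpa using hN hα
        simpa [hα1] using (real_inner_le_norm α y).trans
          (mul_le_mul_of_nonneg_left (hnorm y hy) (norm_nonneg α))
      have hxx : ⟪‖x‖⁻¹ • x, x⟫ = ‖x‖ := by
        have := norm_ne_zero_iff.2 hx0
        rw [real_inner_smul_left, real_inner_self_eq_norm_sq]
        field_simp
      rw [hxx] at h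
      linarith
  obtain ⟨α, -, hd, h⟩ := key θ hθ
  have hlip := suppFn_le_add hcomp hne hnorm α θ
  have hdR : ‖α - θ‖ * R ≤ δ / 2 := hεR ▸ mul_le_mul_of_nonneg_right hd hR0.le
  have hone : 1 ≤ suppFn K θ := by
    have := inner_le_suppFn hcomp θ (hball (show θ ∈ Metric.closedBall 0 1 by simp [hθ]))
    rwa [real_inner_self_eq_norm_sq, hθ, one_pow] at this
  have hs0 : 0 ≤ ε * ‖x‖ := by positivity
  have hs : ε * ‖x‖ * (1 - ε) ≤ δ / 2 := by
    rw [← hεR, mul_assoc]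
    exact mul_le_mul_of_nonneg_left hxR hε0.le
  have hs' : (1 - δ) * (ε * ‖x‖) ≤ δ / 2 := by
    have := mul_le_mul_of_nonneg_left (show 1 - δ ≤ 1 - ε by linarith) hs0
    linarith
  have hin : ⟪θ, x⟫ ≤ suppFn K θ + δ / 2 + ε * ‖x‖ := by linarith
  have hmul := mul_le_mul_of_nonneg_left hin (show 0 ≤ 1 - δ by linarith)
  nlinarith [mul_le_mul_of_nonneg_left hone hδ0.le, sq_nonneg δ]
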